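/- ℓ₁-norm decomposition inequality (inequality (B5)). Let d ≥ 1, S ⊆ {1,…,d}, and β, β* ∈ ℝ^d with β*_j = 0 for all j ∉ S. For v ∈ ℝ^d, write v_S for the vector that agrees with v on S and is zero off S, and v_{S^c} := v − v_S, and let ||·||₁ denote the ℓ₁ norm. If ||β_{S^c}||₁ ≥ 7 ||β_S − β*||₁, then ||β*||₁ + (1/2)||β − β*||₁ ≤ ||β||₁ − (1/4)||β − β*||₁. -/

import Mathlib

noncomputable section

/-- The ℓ₁ norm on `ℝ^d`. -/
def l1 {d : ℕ} (v : Fin d → ℝ) : ℝ := ∑ j, |v j|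

/-- `restr S v` agrees with `v` on `S` and is zero off `S`. -/
def restr {d : ℕ} (S : Finset (Fin d)) (v : Fin d → ℝ) : Fin d → ℝ :=
  fun j => if j ∈ S then v j else 0

/-- ℓ₁-norm decomposition inequality (inequality (B5)). -/
theorem l1_decomposition_inequality (d : ℕ) (hd : 1 ≤ d) (S : Finset (Fin d))
    (β βstar : Fin d → ℝ) (hsupp : ∀ j ∉ S, βstar j = 0)
    (hcond : 7 * l1 (restr S β - βstar) ≤ l1 (restr Sᶜ β)) :
    l1 βstar + (1 / 2) * l1 (β - βstar) ≤ l1 β - (1 / 4) * l1 (β - βstar) := by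
  have key : ∀ j, |βstar j| + (3 / 4) * |(β - βstar) j| - |β j| ≤
      (7 / 4) * |(restr S β - βstar) j| - (1 / 4) * |restr Sᶜ β j| := by
    intro j
    by_cases hj : j ∈ S
    · have h := abs_sub_abs_le_abs_sub (βstar j) (β j)
      rw [abs_sub_comm] at h
      simp only [restr, Pi.sub_apply, hj, Finset.mem_compl, if_true, not_true_eq_false, if_false,
        abs_zero]
      linarith
    · simp only [restr, Pi.sub_apply, hj, Finset.mem_compl, not_false_eq_true, if_true, if_false,
        hsupp j hj, sub_zero, abs_zero]
      linarith
  have hsum := Finset.sum_le_sum fun j (_ : j ∈ Finset.univ) => key j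
  simp only [Finset.sum_sub_distrib, Finset.sum_add_distrib, ← Finset.mul_sum] at hsum
  unfold l1 at *
  linarith
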